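/- Let u be a real number with 0 < u < log((3+√5)/2), ξ := u + 2π√-1, and w₀(u) := (φ(u) + 2π√-1)/ξ. Then the function u ↦ Im(ξΦ(w₀(u))) = 2 Im Li₂(e^{-u-φ(u)}) + u·Im φ(u) is differentiable with derivative 2 arg(1 - e^{-u-φ(u)}) + Im φ(u) < 0 (arg the principal argument); hence Im(ξΦ(w₀(u))) is strictly decreasing on (0, log((3+√5)/2)). Moreover its limit as u → 0 equals 2 Im Li₂(e^{√-1 π/3}) and its limit as u → log((3+√5)/2) equals 0. -/

import Mathlib

open Complex MeasureTheory Filter Topology Finset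

noncomputable section

/-- The dilogarithm `Li₂(z) = -∫₀^z log(1-x)/x dx` along the segment from `0` to `z`. -/
def dilog (z : ℂ) : ℂ := -∫ t in (0:ℝ)..1, Complex.log (1 - (t:ℂ) * z) / (t:ℂ)

/-- Colored Jones polynomial of the figure-eight knot (Habiro–Le formula). -/
def JE (N : ℕ) (q : ℂ) : ℂ :=
  ∑ k ∈ Finset.range N, ∏ l ∈ Finset.Icc 1 k,
    ((q ^ (((N:ℂ) - (l:ℂ))/2) - q ^ (-(((N:ℂ) - (l:ℂ))/2))) *
     (q ^ (((N:ℂ) + (l:ℂ))/2) - q ^ (-(((N:ℂ) + (l:ℂ))/2))))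

/-- Integral over the contour `C_R = (-∞,-R] ∪ Ω_R ∪ [R,∞)`, where `Ω_R` is the upper
semicircle of radius `R` traversed from `-R` to `R`. -/
def contourCR (R : ℝ) (f : ℂ → ℂ) : ℂ :=
  (∫ t in Set.Iic (-R), f (t:ℂ)) +
  (∫ s in (0:ℝ)..Real.pi,
      f ((R:ℂ) * Complex.exp (Complex.I * ((Real.pi:ℂ) - (s:ℂ)))) *
        (-Complex.I * (R:ℂ) * Complex.exp (Complex.I * ((Real.pi:ℂ) - (s:ℂ))))) +
  (∫ t in Set.Ici R, f (t:ℂ))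

/-- Faddeev's quantum dilogarithm `S_γ(z)`. -/
def Sqd (γ : ℂ) (R : ℝ) (z : ℂ) : ℂ :=
  Complex.exp ((1/4) * contourCR R
    (fun t => Complex.exp (z * t) / (Complex.sinh ((Real.pi:ℂ) * t) * Complex.sinh (γ * t) * t)))

/-- The square root of `(e^u+e^{-u}+1)(e^u+e^{-u}-3)` chosen as a positive multiple of `√-1`. -/
def betaRoot (u : ℝ) : ℂ :=
  Complex.I * (Real.sqrt (-((Real.exp u + Real.exp (-u) + 1) * (Real.exp u + Real.exp (-u) - 3))) : ℝ)

/-- `φ(u) = arccosh(cosh u - 1/2)` with the branch described in the paper. -/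
def phiu (u : ℝ) : ℂ :=
  Complex.log (((Real.exp u + Real.exp (-u) - 1 : ℝ) - betaRoot u) / 2)

/-- `S(u) = Li₂(e^{u-φ(u)}) - Li₂(e^{u+φ(u)}) - uφ(u)`. -/
def Su (u : ℝ) : ℂ :=
  dilog (Complex.exp ((u:ℂ) - phiu u)) - dilog (Complex.exp ((u:ℂ) + phiu u)) - (u:ℂ) * phiu u

/-- `Φ(w) = (1/ξ)(Li₂(e^{u-ξw}) - Li₂(e^{u+ξw})) - uw` with `ξ = u + 2π√-1`. -/
def Phi (u : ℝ) (w : ℂ) : ℂ :=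
  (1/((u:ℂ) + 2*(Real.pi:ℂ)*Complex.I)) *
    (dilog (Complex.exp ((u:ℂ) - ((u:ℂ) + 2*(Real.pi:ℂ)*Complex.I) * w)) -
     dilog (Complex.exp ((u:ℂ) + ((u:ℂ) + 2*(Real.pi:ℂ)*Complex.I) * w))) - (u:ℂ) * w

/-- `g_N(w) = e^{-Nuw} S_γ(π-√-1u+√-1ξw)/S_γ(-π-√-1u-√-1ξw)`, `γ = (2π-√-1u)/(2N)`. -/
def gN (u : ℝ) (N : ℕ) (R : ℝ) (w : ℂ) : ℂ :=
  Complex.exp (-(N:ℂ) * (u:ℂ) * w) *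
    Sqd ((2*(Real.pi:ℂ) - Complex.I*(u:ℂ))/(2*(N:ℂ))) R
      ((Real.pi:ℂ) - Complex.I*(u:ℂ) + Complex.I*((u:ℂ) + 2*(Real.pi:ℂ)*Complex.I)*w) /
    Sqd ((2*(Real.pi:ℂ) - Complex.I*(u:ℂ))/(2*(N:ℂ))) R
      (-(Real.pi:ℂ) - Complex.I*(u:ℂ) - Complex.I*((u:ℂ) + 2*(Real.pi:ℂ)*Complex.I)*w)

/-- Integral of `f` along the straight segment from `a` to `b`. -/
def segInt (f : ℂ → ℂ) (a b : ℂ) : ℂ :=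
  ∫ t in (0:ℝ)..1, f (a + (t:ℂ) * (b - a)) * (b - a)

/-- Integral of `f` along the polygonal line through the given list of vertices. -/
def polyInt (f : ℂ → ℂ) : List ℂ → ℂ
  | a :: b :: rest => segInt f a b + polyInt f (b :: rest)
  | _ => 0

/-- Vertices of the polygonal line `C_+(ε)`. -/
def Cplus (u ε : ℝ) : List ℂ :=
  [((1 - ε : ℝ) : ℂ),
   ((1 - u/(2*Real.pi) - ε : ℝ) : ℂ) + Complex.I,
   ((-(u/(2*Real.pi)) + ε : ℝ) : ℂ) + Complex.I,
   ((ε : ℝ) : ℂ)]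

/-- Vertices of the polygonal line `C_-(ε)`. -/
def Cminus (u ε : ℝ) : List ℂ :=
  [((ε : ℝ) : ℂ),
   ((u/(2*Real.pi) : ℝ) : ℂ) - Complex.I,
   ((1 + u/(2*Real.pi) : ℝ) : ℂ) - Complex.I,
   ((1 - ε : ℝ) : ℂ)]

/-- `I_γ(z)` from Andersen–Hansen. -/
def Iqd (γ : ℂ) (R : ℝ) (z : ℂ) : ℂ :=
  (1/4) * contourCR R
    (fun t => Complex.exp (z * t) / (t * Complex.sinh ((Real.pi:ℂ) * t)) *
      (1/Complex.sinh (γ * t) - 1/(γ * t)))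

end

/-- The function `u ↦ Im(ξΦ(w₀(u)))`. -/
noncomputable def FIm (u : ℝ) : ℝ :=
  (((u:ℂ) + 2*(Real.pi:ℂ)*Complex.I) *
    Phi u ((phiu u + 2*(Real.pi:ℂ)*Complex.I)/((u:ℂ) + 2*(Real.pi:ℂ)*Complex.I))).im

theorem one_sub_ofReal_mul_mem_slitPlane {z : ℂ} (hz : 1 - z ∈ slitPlane) {t : ℝ}
    (ht : t ∈ Set.Icc (0 : ℝ) 1) : 1 - (t : ℂ) * z ∈ slitPlane := by
  have h := StarConvex.add_smul_mem starConvex_one_slitPlane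
    (y := -z) (by simpa [sub_eq_add_neg] using hz) ht.1 ht.2
  simpa [sub_eq_add_neg] using h

theorem hasDerivAt_log_one_sub_ofReal_mul {z : ℂ} {t : ℝ} (h : 1 - (t : ℂ) * z ∈ slitPlane) :
    HasDerivAt (fun s : ℝ => Complex.log (1 - (s : ℂ) * z)) (-z / (1 - (t : ℂ) * z)) t := by
  refine HasDerivAt.clog_real ?_ h
  simpa using ((Complex.ofRealCLM.hasDerivAt (x := t)).mul_const z).const_sub 1

theorem intervalIntegrable_log_one_sub_div {z : ℂ} (hz : 1 - z ∈ slitPlane) :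
    IntervalIntegrable (fun t : ℝ => Complex.log (1 - (t : ℂ) * z) / (t : ℂ)) volume 0 1 := by
  set f : ℝ → ℂ := fun t => Complex.log (1 - (t : ℂ) * z) with hf
  have hdiff : ∀ t ∈ Set.Icc (0 : ℝ) 1, DifferentiableAt ℝ f t := fun t ht =>
    (hasDerivAt_log_one_sub_ofReal_mul
      (one_sub_ofReal_mul_mem_slitPlane hz ht)).differentiableAt
  have hcont : ContinuousOn (dslope f 0) (Set.uIcc 0 1) := by
    intro t ht
    rw [Set.uIcc_of_le zero_le_one] at ht
    refine ContinuousAt.continuousWithinAt ?_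
    rcases eq_or_ne t 0 with rfl | h
    · exact continuousAt_dslope_same.2 (hdiff 0 (by simp))
    · exact (continuousAt_dslope_of_ne h).2 (hdiff t ht).continuousAt
  refine hcont.intervalIntegrable.congr ?_
  intro t ht
  rw [Set.uIoc_of_le zero_le_one] at ht
  simp only [dslope_of_ne f ht.1.ne', slope_def_module]
  simp [hf, div_eq_inv_mul]

theorem integral_inv_one_sub_ofReal_mul {z : ℂ} (hz : 1 - z ∈ slitPlane) (hz0 : z ≠ 0) :
    ∫ t in (0 : ℝ)..1, -(1 - (t : ℂ) * z)⁻¹ = Complex.log (1 - z) / z := by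
  have hmem : ∀ t ∈ Set.uIcc (0 : ℝ) 1, 1 - (t : ℂ) * z ∈ slitPlane := fun t ht =>
    one_sub_ofReal_mul_mem_slitPlane hz (by rwa [Set.uIcc_of_le zero_le_one] at ht)
  have h := intervalIntegral.integral_eq_sub_of_hasDerivAt (a := 0) (b := 1)
    (f := fun t : ℝ => Complex.log (1 - (t : ℂ) * z) / z)
    (f' := fun t : ℝ => -(1 - (t : ℂ) * z)⁻¹)
    (fun t ht => by
      refine ((hasDerivAt_log_one_sub_ofReal_mul (hmem t ht)).div_const z).congr_deriv ?_
      rw [neg_div, neg_div, div_right_comm, div_self hz0, one_div])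
    (ContinuousOn.intervalIntegrable fun t ht =>
      by
      have := slitPlane_ne_zero (hmem t ht)
      exact ContinuousAt.continuousWithinAt (by fun_prop (disch := assumption)))
  simpa using h

/-- The dilogarithm is holomorphic off the cut `[1, ∞)`, with derivative `-log(1-z)/z`. -/
theorem hasDerivAt_dilog {z : ℂ} (hz : 1 - z ∈ slitPlane) (hz0 : z ≠ 0) :
    HasDerivAt dilog (-(Complex.log (1 - z) / z)) z := by
  have hopen : IsOpen {w : ℂ | 1 - w ∈ slitPlane} :=
    isOpen_slitPlane.preimage (by fun_prop : Continuous fun w : ℂ => 1 - w)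
  obtain ⟨ε, hε, hball⟩ := Metric.nhds_basis_closedBall.mem_iff.1 (hopen.mem_nhds hz)
  have hmem : ∀ t ∈ Set.Icc (0 : ℝ) 1, ∀ w ∈ Metric.closedBall z ε,
      1 - (t : ℂ) * w ∈ slitPlane := fun t ht w hw =>
    one_sub_ofReal_mul_mem_slitPlane (hball hw) ht
  obtain ⟨C, hC⟩ := (isCompact_Icc.prod (isCompact_closedBall z ε)).exists_bound_of_continuousOn
    (s := Set.Icc (0 : ℝ) 1 ×ˢ Metric.closedBall z ε)
    (f := fun p : ℝ × ℂ => -(1 - (p.1 : ℂ) * p.2)⁻¹) (fun p hp =>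
      by
      have := slitPlane_ne_zero (hmem p.1 hp.1 p.2 hp.2)
      exact ContinuousAt.continuousWithinAt (by fun_prop (disch := assumption)))
  have hsub : Set.uIoc (0 : ℝ) 1 ⊆ Set.Icc 0 1 := by
    rw [Set.uIoc_of_le zero_le_one]; exact Set.Ioc_subset_Icc_self
  have key := intervalIntegral.hasDerivAt_integral_of_dominated_loc_of_deriv_le
    (𝕜 := ℂ) (μ := volume) (a := 0) (b := 1)
    (F := fun w t => Complex.log (1 - (t : ℂ) * w) / (t : ℂ))
    (F' := fun w t => -(1 - (t : ℂ) * w)⁻¹) (bound := fun _ => C)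
    (Metric.closedBall_mem_nhds z hε)
    (Eventually.of_forall fun w => (Measurable.aestronglyMeasurable (by fun_prop)))
    (intervalIntegrable_log_one_sub_div hz)
    (Measurable.aestronglyMeasurable (by fun_prop))
    (Eventually.of_forall fun t ht w hw => hC (t, w) ⟨hsub ht, hw⟩)
    intervalIntegrable_const
    (Eventually.of_forall fun t ht w hw => by
      have ht0 : (t : ℂ) ≠ 0 := by
        rw [Set.uIoc_of_le zero_le_one] at ht
        exact_mod_cast ht.1.ne'
      have h1 : HasDerivAt (fun w : ℂ => 1 - (t : ℂ) * w) (-t) w := by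
        simpa using ((hasDerivAt_id w).const_mul (t : ℂ)).const_sub 1
      refine ((h1.clog (hmem t (hsub ht) w hw)).div_const (t : ℂ)).congr_deriv ?_
      rw [neg_div, neg_div, div_right_comm, div_self ht0, one_div])
  rw [← integral_inv_one_sub_ofReal_mul hz hz0]
  exact key.2.neg

theorem dilog_conj {z : ℂ} (hz : 1 - z ∈ slitPlane) :
    dilog ((starRingEnd ℂ) z) = (starRingEnd ℂ) (dilog z) := by
  rw [dilog, dilog, map_neg, ← intervalIntegral.intervalIntegral_conj]
  congr 1
  refine intervalIntegral.integral_congr fun t ht => ?_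
  rw [Set.uIcc_of_le zero_le_one] at ht
  have h := mem_slitPlane_iff_arg.1 (one_sub_ofReal_mul_mem_slitPlane hz ht)
  simp [← Complex.log_conj _ h.1]

/-- Imaginary part of `log(1-z) = log(1-z⁻¹) + log(-z)` at `z = e^{v+iθ}`, with the term in `z⁻¹`
conjugated. -/
theorem arg_one_sub_exp_add_arg {θ : ℝ} (h0 : 0 < θ) (hπ : θ < Real.pi) (v : ℝ) :
    arg (1 - exp ((v : ℂ) + θ * I)) + arg (1 - exp (-(v : ℂ) + θ * I)) = θ - Real.pi := by
  have hsin := Real.sin_pos_of_pos_of_lt_pi h0 hπ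
  set w : ℂ := 1 - exp (-(v : ℂ) + θ * I) with hw
  have hwim : w.im < 0 := by
    have : 0 < Real.exp (-v) * Real.sin θ := by positivity
    simpa [hw, exp_im] using this
  have hw0 : w ≠ 0 := fun h => by simp [h] at hwim
  have hargneg := arg_neg_iff.2 hwim
  have hlow := neg_pi_lt_arg w
  have hconj : arg ((starRingEnd ℂ) w) = -arg w := by
    rw [arg_conj, if_neg (by linarith)]
  have hfac : 1 - exp ((v : ℂ) + θ * I)
      = (Real.exp v : ℂ) * (exp ((θ - Real.pi : ℝ) * I) * (starRingEnd ℂ) w) := by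
    have e1 : exp (((θ - Real.pi : ℝ) : ℂ) * I) = -exp (θ * I) := by
      push_cast
      rw [sub_mul, Complex.exp_sub, exp_pi_mul_I, div_neg, div_one]
    have e2 : (starRingEnd ℂ) w = 1 - exp (-(v : ℂ) - θ * I) := by
      simp [hw, ← exp_conj, sub_eq_add_neg]
    rw [e1, e2, ofReal_exp]
    have : exp (v : ℂ) * (exp (θ * I) * exp (-(v : ℂ) - θ * I)) = 1 := by
      rw [← Complex.exp_add, ← Complex.exp_add]; simp
    rw [Complex.exp_add]
    linear_combination -this
  have harg : arg (exp ((θ - Real.pi : ℝ) * I)) = θ - Real.pi := by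
    rw [exp_mul_I]
    exact arg_cos_add_sin_mul_I ⟨by linarith, by linarith⟩
  rw [hfac, arg_real_mul _ (Real.exp_pos v), (arg_mul_eq_add_arg_iff (exp_ne_zero _) (by simpa)).2,
    harg, hconj]
  · ring
  · rw [harg, hconj]; exact ⟨by linarith, by linarith⟩

theorem one_sub_exp_mem_slitPlane {θ : ℝ} (h0 : 0 < θ) (hπ : θ < Real.pi) (v : ℝ) :
    1 - exp ((v : ℂ) + θ * I) ∈ slitPlane := by
  have : 0 < Real.exp v * Real.sin θ := by
    have := Real.sin_pos_of_pos_of_lt_pi h0 hπ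
    positivity
  refine mem_slitPlane_iff.2 (Or.inr ?_)
  simpa [exp_im, -mul_eq_zero] using this.ne'

/-- Derivative of the imaginary part of the dilogarithm along an exponential curve. -/
theorem hasDerivAt_im_dilog_exp {p : ℝ → ℂ} {p' : ℂ} {v : ℝ} (hp : HasDerivAt p p' v)
    (hz : 1 - exp (p v) ∈ slitPlane) :
    HasDerivAt (fun s => (dilog (exp (p s))).im) (-(Complex.log (1 - exp (p v)) * p').im) v := by
  have h := (hasDerivAt_dilog hz (exp_ne_zero _)).comp v hp.cexp
  have := Complex.imCLM.hasFDerivAt.comp_hasDerivAt v h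
  refine this.congr_deriv ?_
  have : (1 - exp (p v)).log / exp (p v) * (exp (p v) * p') = (1 - exp (p v)).log * p' := by
    field_simp [exp_ne_zero]
  simp [← this]

/-- Imaginary part of the inversion formula `Li₂(z) + Li₂(1/z) = -π²/6 - log(-z)²/2` at
`z = e^{v+iθ}`. -/
theorem im_dilog_exp_add {θ : ℝ} (h0 : 0 < θ) (hπ : θ < Real.pi) (v : ℝ) :
    (dilog (exp ((v : ℂ) + θ * I))).im =
      (dilog (exp (-(v : ℂ) + θ * I))).im + v * (Real.pi - θ) := by
  set g : ℝ → ℝ := fun v => (dilog (exp ((v : ℂ) + θ * I))).im -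
    (dilog (exp (-(v : ℂ) + θ * I))).im - v * (Real.pi - θ) with hg
  have hder : ∀ v, HasDerivAt g 0 v := by
    intro v
    have p1 : HasDerivAt (fun v : ℝ => (v : ℂ) + θ * I) 1 v := by
      simpa using (Complex.ofRealCLM.hasDerivAt (x := v)).add_const (θ * I)
    have p2 : HasDerivAt (fun v : ℝ => -(v : ℂ) + θ * I) (-1) v := by
      simpa using (Complex.ofRealCLM.hasDerivAt (x := v)).neg.add_const (θ * I)
    have d1 := hasDerivAt_im_dilog_exp p1 (one_sub_exp_mem_slitPlane h0 hπ v)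
    have d2 := hasDerivAt_im_dilog_exp p2
      (by simpa using one_sub_exp_mem_slitPlane h0 hπ (-v))
    refine ((d1.sub d2).sub ((hasDerivAt_id v).mul_const (Real.pi - θ))).congr_deriv ?_
    have := arg_one_sub_exp_add_arg h0 hπ v
    simp only [mul_one, mul_neg, neg_im, log_im, one_mul]
    linarith
  have h := is_const_of_deriv_eq_zero (fun v => (hder v).differentiableAt)
    (fun v => (hder v).deriv) v 0
  simp only [hg, ofReal_zero, neg_zero, sub_self, zero_mul] at h
  linarith

/-- The angle `θ(u) = -Im φ(u)`. -/
noncomputable def phiAngle (u : ℝ) : ℝ := Real.arccos (Real.cosh u - 1 / 2)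

theorem continuous_phiAngle : Continuous phiAngle :=
  Real.continuous_arccos.comp (Real.continuous_cosh.sub continuous_const)

theorem cos_phiAngle {u : ℝ} (hu : Real.cosh u ≤ 3 / 2) :
    Real.cos (phiAngle u) = Real.cosh u - 1 / 2 :=
  Real.cos_arccos (by linarith [Real.one_le_cosh u]) (by linarith)

theorem phiAngle_lt_pi (u : ℝ) : phiAngle u < Real.pi := by
  have : phiAngle u ≤ Real.pi / 2 :=
    Real.arccos_le_pi_div_two.2 (by linarith [Real.one_le_cosh u])
  linarith [Real.pi_pos]

theorem phiAngle_pos {u : ℝ} (hu : Real.cosh u < 3 / 2) : 0 < phiAngle u :=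
  Real.arccos_pos.2 (by linarith)

theorem phiAngle_zero : phiAngle 0 = Real.pi / 3 := by
  rw [phiAngle, Real.cosh_zero, show (1 : ℝ) - 1 / 2 = Real.cos (Real.pi / 3) by
    rw [Real.cos_pi_div_three]; norm_num, Real.arccos_cos] <;> linarith [Real.pi_pos]

theorem phiu_eq {u : ℝ} (hu : Real.cosh u ≤ 3 / 2) : phiu u = -(phiAngle u * I) := by
  have hx : Real.exp u + Real.exp (-u) = 2 * Real.cosh u := by rw [Real.cosh_eq]; ring
  have hsin : Real.sqrt (-((2 * Real.cosh u + 1) * (2 * Real.cosh u - 3)))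
      = 2 * Real.sin (phiAngle u) := by
    rw [phiAngle, Real.sin_arccos, show -((2 * Real.cosh u + 1) * (2 * Real.cosh u - 3))
      = 2 ^ 2 * (1 - (Real.cosh u - 1 / 2) ^ 2) by ring, Real.sqrt_mul (by norm_num),
      Real.sqrt_sq (by norm_num)]
  have harg : ((Real.exp u + Real.exp (-u) - 1 : ℝ) - betaRoot u) / 2
      = exp (-(phiAngle u * I)) := by
    rw [betaRoot, hx, hsin, ← neg_mul, exp_mul_I, Complex.cos_neg, Complex.sin_neg, ← ofReal_cos,
      ← ofReal_sin, cos_phiAngle hu]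
    push_cast
    ring
  have hpos : 0 ≤ phiAngle u := Real.arccos_nonneg _
  rw [phiu, harg, Complex.log_exp]
  · simpa using phiAngle_lt_pi u
  · simp only [neg_im, mul_im, ofReal_re, I_im, mul_one, ofReal_im, I_re, mul_zero, add_zero]
    linarith [Real.pi_pos]

/-- `2 Im Li₂(e^{-u-φ(u)}) + u Im φ(u)` in terms of `θ(u)`. -/
noncomputable def reducedPotential (u : ℝ) : ℝ :=
  2 * (dilog (exp (-(u : ℂ) + phiAngle u * I))).im - u * phiAngle u

theorem FIm_eq_reducedPotential {u : ℝ} (hu : Real.cosh u < 3 / 2) :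
    FIm u = reducedPotential u := by
  have h0 := phiAngle_pos hu
  have hπ := phiAngle_lt_pi u
  have hξ : (u : ℂ) + 2 * (Real.pi : ℂ) * I ≠ 0 := fun h => by
    have := congrArg Complex.im h
    simp at this
  set θ := phiAngle u
  have hmul : ((u : ℂ) + 2 * (Real.pi : ℂ) * I) *
      ((phiu u + 2 * (Real.pi : ℂ) * I) / ((u : ℂ) + 2 * (Real.pi : ℂ) * I))
      = -(θ * I) + 2 * (Real.pi : ℂ) * I := by
    rw [mul_div_cancel₀ _ hξ, phiu_eq hu.le]
  have e1 : exp ((u : ℂ) - (-(θ * I) + 2 * (Real.pi : ℂ) * I)) = exp ((u : ℂ) + θ * I) := by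
    rw [← exp_periodic.sub_eq ((u : ℂ) + θ * I)]; congr 1; ring
  have e2 : exp ((u : ℂ) + (-(θ * I) + 2 * (Real.pi : ℂ) * I))
      = (starRingEnd ℂ) (exp ((u : ℂ) + θ * I)) := by
    rw [← exp_conj, ← exp_periodic ((starRingEnd ℂ) ((u : ℂ) + θ * I))]; congr 1; simp; ring
  have hmain : ((u : ℂ) + 2 * (Real.pi : ℂ) * I) *
      Phi u ((phiu u + 2 * (Real.pi : ℂ) * I) / ((u : ℂ) + 2 * (Real.pi : ℂ) * I))
      = dilog (exp ((u : ℂ) + θ * I)) - (starRingEnd ℂ) (dilog (exp ((u : ℂ) + θ * I)))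
        - u * (-(θ * I) + 2 * (Real.pi : ℂ) * I) := by
    rw [Phi, hmul, e1, e2, dilog_conj (one_sub_exp_mem_slitPlane h0 hπ u), phiu_eq hu.le]
    field_simp
    ring
  rw [FIm, hmain, reducedPotential]
  simp only [sub_im, add_im, neg_im, mul_im, conj_im, im_dilog_exp_add h0 hπ u, ofReal_re,
    ofReal_im, I_re, I_im, mul_re]
  simp
  ring

theorem log_norm_one_sub_exp {u : ℝ} (hu : Real.cosh u ≤ 3 / 2) :
    Real.log ‖1 - exp (-(u : ℂ) + phiAngle u * I)‖ = -u / 2 := by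
  have hsq : ‖1 - exp (-(u : ℂ) + phiAngle u * I)‖ ^ 2 = Real.exp (-u) := by
    have hE : Real.exp (-u) * Real.exp u = 1 := by rw [← Real.exp_add]; simp
    have hre : (1 - exp (-(u : ℂ) + phiAngle u * I)).re
        = 1 - Real.exp (-u) * Real.cos (phiAngle u) := by simp [exp_re]
    have him : (1 - exp (-(u : ℂ) + phiAngle u * I)).im
        = -(Real.exp (-u) * Real.sin (phiAngle u)) := by simp [exp_im]
    rw [Complex.sq_norm, normSq_apply, hre, him]
    have hc := cos_phiAngle hu
    rw [Real.cosh_eq] at hc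
    have hs := Real.sin_sq_add_cos_sq (phiAngle u)
    linear_combination (Real.exp (-u)) ^ 2 * hs - 2 * Real.exp (-u) * hc - hE
  have := congrArg Real.log hsq
  rw [Real.log_pow, Real.log_exp] at this
  push_cast at this
  linarith

theorem hasDerivAt_reducedPotential {u : ℝ} (hu : Real.cosh u < 3 / 2) :
    HasDerivAt reducedPotential
      (2 * arg (1 - exp (-(u : ℂ) + phiAngle u * I)) - phiAngle u) u := by
  have hθ : DifferentiableAt ℝ phiAngle u := by
    have h1 : Real.cosh u - 1 / 2 ≠ -1 := by linarith [Real.one_le_cosh u]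
    have h2 : Real.cosh u - 1 / 2 ≠ 1 := by linarith
    exact (Real.differentiableAt_arccos.2 ⟨h1, h2⟩).comp u
      (Real.differentiable_cosh.differentiableAt.sub_const _)
  obtain ⟨θ', hθ'⟩ : ∃ θ', HasDerivAt phiAngle θ' u := ⟨_, hθ.hasDerivAt⟩
  have hp : HasDerivAt (fun v : ℝ => -(v : ℂ) + phiAngle v * I) (-1 + θ' * I) u :=
    (Complex.ofRealCLM.hasDerivAt (x := u)).neg.add (hθ'.ofReal_comp.mul_const I)
  have hz := one_sub_exp_mem_slitPlane (phiAngle_pos hu) (phiAngle_lt_pi u) (-u)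
  rw [ofReal_neg] at hz
  refine (((hasDerivAt_im_dilog_exp hp hz).const_mul 2).sub
    ((hasDerivAt_id u).mul hθ')).congr_deriv ?_
  have hre := log_norm_one_sub_exp hu.le
  simp [log_re, log_im, hre]
  ring

theorem arg_one_sub_exp_neg {θ : ℝ} (h0 : 0 < θ) (hπ : θ < Real.pi) (v : ℝ) :
    arg (1 - exp ((v : ℂ) + θ * I)) < 0 := by
  have := mul_pos (Real.exp_pos v) (Real.sin_pos_of_pos_of_lt_pi h0 hπ)
  exact arg_neg_iff.2 (by simpa [exp_im] using this)

theorem continuousAt_reducedPotential {u : ℝ}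
    (hz : 1 - exp (-(u : ℂ) + phiAngle u * I) ∈ slitPlane) :
    ContinuousAt reducedPotential u := by
  have hθ := continuous_phiAngle
  have h1 : ContinuousAt (fun v : ℝ => exp (-(v : ℂ) + phiAngle v * I)) u := by fun_prop
  have h2 : ContinuousAt (fun v : ℝ => dilog (exp (-(v : ℂ) + phiAngle v * I))) u :=
    ContinuousAt.comp (f := fun v : ℝ => exp (-(v : ℂ) + phiAngle v * I))
      (hasDerivAt_dilog hz (exp_ne_zero _)).continuousAt h1
  exact ((Complex.continuous_im.continuousAt.comp h2).const_mul 2).sub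
    (continuous_id.mul hθ).continuousAt

theorem log_three_add_sqrt_five_pos : 0 < Real.log ((3 + Real.sqrt 5) / 2) :=
  Real.log_pos (by linarith [Real.sqrt_nonneg 5])

theorem cosh_log_three_add_sqrt_five : Real.cosh (Real.log ((3 + Real.sqrt 5) / 2)) = 3 / 2 := by
  have h5 : Real.sqrt 5 ^ 2 = 5 := Real.sq_sqrt (by norm_num)
  have hpos : 0 < (3 + Real.sqrt 5) / 2 := by positivity
  rw [Real.cosh_log hpos]
  field_simp
  linear_combination h5

theorem cosh_lt_of_mem_Ioo {u : ℝ}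
    (hu : u ∈ Set.Ioo (0 : ℝ) (Real.log ((3 + Real.sqrt 5) / 2))) : Real.cosh u < 3 / 2 := by
  rw [← cosh_log_three_add_sqrt_five, Real.cosh_lt_cosh, abs_of_pos hu.1,
    abs_of_pos log_three_add_sqrt_five_pos]
  exact hu.2

/-- `Im(ξΦ(w₀(u))) = 2 Im Li₂(e^{-u-φ(u)}) + u Im φ(u)` is
differentiable with negative derivative `2 arg(1-e^{-u-φ(u)}) + Im φ(u)`, hence
strictly decreasing on `(0, log((3+√5)/2))`, with limits `2 Im Li₂(e^{√-1π/3})`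
at `0` and `0` at `log((3+√5)/2)`. -/
theorem stmt19 :
    (∀ u ∈ Set.Ioo (0:ℝ) (Real.log ((3 + Real.sqrt 5)/2)),
      FIm u = 2 * (dilog (Complex.exp (-(u:ℂ) - phiu u))).im + u * (phiu u).im) ∧
    (∀ u ∈ Set.Ioo (0:ℝ) (Real.log ((3 + Real.sqrt 5)/2)),
      HasDerivAt FIm
        (2 * Complex.arg (1 - Complex.exp (-(u:ℂ) - phiu u)) + (phiu u).im) u ∧
      2 * Complex.arg (1 - Complex.exp (-(u:ℂ) - phiu u)) + (phiu u).im < 0) ∧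
    StrictAntiOn FIm (Set.Ioo (0:ℝ) (Real.log ((3 + Real.sqrt 5)/2))) ∧
    Filter.Tendsto FIm (nhdsWithin 0 (Set.Ioi 0))
      (nhds (2 * (dilog (Complex.exp (Complex.I*(Real.pi:ℂ)/3))).im)) ∧
    Filter.Tendsto FIm
      (nhdsWithin (Real.log ((3 + Real.sqrt 5)/2)) (Set.Iio (Real.log ((3 + Real.sqrt 5)/2))))
      (nhds 0) := by
  set L := Real.log ((3 + Real.sqrt 5)/2) with hL
  have hLpos : 0 < L := log_three_add_sqrt_five_pos
  have hφ : ∀ u ∈ Set.Ioo (0:ℝ) L, phiu u = -(phiAngle u * I) := fun u hu =>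
    phiu_eq (cosh_lt_of_mem_Ioo hu).le
  have hexp : ∀ u ∈ Set.Ioo (0:ℝ) L, -(u:ℂ) - phiu u = -(u:ℂ) + phiAngle u * I := fun u hu => by
    rw [hφ u hu, sub_neg_eq_add]
  have him : ∀ u ∈ Set.Ioo (0:ℝ) L, (phiu u).im = -phiAngle u := fun u hu => by
    simp [hφ u hu]
  have hF : Set.EqOn FIm reducedPotential (Set.Ioo 0 L) := fun u hu =>
    FIm_eq_reducedPotential (cosh_lt_of_mem_Ioo hu)
  have hderiv : ∀ u ∈ Set.Ioo (0:ℝ) L,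
      HasDerivAt FIm
        (2 * Complex.arg (1 - Complex.exp (-(u:ℂ) - phiu u)) + (phiu u).im) u ∧
      2 * Complex.arg (1 - Complex.exp (-(u:ℂ) - phiu u)) + (phiu u).im < 0 := by
    intro u hu
    have hc := cosh_lt_of_mem_Ioo hu
    rw [hexp u hu, him u hu, ← sub_eq_add_neg]
    refine ⟨(hasDerivAt_reducedPotential hc).congr_of_eventuallyEq
      (hF.eventuallyEq_of_mem (Ioo_mem_nhds hu.1 hu.2)), ?_⟩
    have := arg_one_sub_exp_neg (phiAngle_pos hc) (phiAngle_lt_pi u) (-u)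
    rw [ofReal_neg] at this
    linarith [phiAngle_pos hc]
  refine ⟨fun u hu => ?_, hderiv, ?_, ?_, ?_⟩
  · rw [hF hu, hexp u hu, him u hu, reducedPotential]
    ring
  · refine strictAntiOn_of_deriv_neg (convex_Ioo 0 L)
      (fun u hu => (hderiv u hu).1.continuousAt.continuousWithinAt) fun u hu => ?_
    rw [interior_Ioo] at hu
    rw [(hderiv u hu).1.deriv]
    exact (hderiv u hu).2
  · have hz : 1 - exp (-((0:ℝ):ℂ) + phiAngle 0 * I) ∈ slitPlane := by
      simpa using one_sub_exp_mem_slitPlane (phiAngle_pos (u := 0) (by norm_num))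
        (phiAngle_lt_pi 0) 0
    have h := (continuousAt_reducedPotential hz).tendsto.mono_left
      (nhdsWithin_le_nhds (s := Set.Ioi 0))
    have hval : reducedPotential 0
        = 2 * (dilog (Complex.exp (Complex.I*(Real.pi:ℂ)/3))).im := by
      have : -((0:ℝ):ℂ) + ((Real.pi / 3 : ℝ):ℂ) * I = Complex.I*(Real.pi:ℂ)/3 := by
        push_cast; ring
      rw [reducedPotential, phiAngle_zero, this]
      ring
    rw [← hval]
    exact h.congr' (hF.symm.eventuallyEq_of_mem (Ioo_mem_nhdsGT hLpos))
  · have hθ : phiAngle L = 0 := by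
      rw [phiAngle, hL, cosh_log_three_add_sqrt_five]; norm_num
    have hreal : exp (-(L:ℂ) + phiAngle L * I) = ((Real.exp (-L) : ℝ) : ℂ) := by
      simp [hθ]
    have hz : 1 - exp (-(L:ℂ) + phiAngle L * I) ∈ slitPlane := by
      rw [hreal]
      refine mem_slitPlane_iff.2 (Or.inl ?_)
      have : Real.exp (-L) < 1 := by simpa using hLpos
      rw [sub_re, one_re, ofReal_re]
      linarith
    have h := (continuousAt_reducedPotential hz).tendsto.mono_left
      (nhdsWithin_le_nhds (s := Set.Iio L))
    have hval : reducedPotential L = 0 := by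
      have hconj := dilog_conj hz
      rw [hreal, conj_ofReal] at hconj
      rw [reducedPotential, hreal, conj_eq_iff_im.1 hconj.symm, hθ]
      ring
    rw [← hval]
    exact h.congr' (hF.symm.eventuallyEq_of_mem (Ioo_mem_nhdsLT hLpos))
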